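/- Let p be a prime, d ≥ 1, and let Γ ≤ GL_d(ℤ/pℤ) be the group of upper triangular unipotent Toeplitz matrices, acting on row vectors of (ℤ/pℤ)^d by y ↦ yA. Then the number of orbits of Γ on (ℤ/pℤ)^d is exactly 1 + (p−1)d. -/

import Mathlib

open Matrix

/-- The upper shift matrix `N` with `N_{i,i+1} = 1` and all other entries `0`. -/
def shiftN (p d : ℕ) : Matrix (Fin d) (Fin d) (ZMod p) :=
  Matrix.of fun i j => if (i : ℕ) + 1 = (j : ℕ) then 1 else 0

theorem shiftN_pow_apply (p d k : ℕ) (i j : Fin d) :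
    (shiftN p d ^ k) i j = if (i : ℕ) + k = j then 1 else 0 := by
  induction k generalizing j with
  | zero => simp [Matrix.one_apply, Fin.ext_iff]
  | succ k ih =>
    rw [pow_succ, Matrix.mul_apply]
    have shiftN_apply (b : Fin d) : shiftN p d b j = if (b : ℕ) + 1 = j then 1 else 0 := rfl
    simp only [ih, shiftN_apply, ite_mul, one_mul, zero_mul]
    by_cases h : (i : ℕ) + k < d
    · rw [Finset.sum_eq_single ⟨i + k, h⟩]
      · simp [add_assoc]
      · intro b _ hb
        rw [if_neg]
        exact fun h' => hb (Fin.ext h'.symm)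
      · simp
    · rw [Finset.sum_eq_zero]
      · rw [if_neg]
        omega
      · intro b _
        rw [if_neg]
        omega

theorem unipotentToeplitz_apply (p d : ℕ) (a : ℕ → ZMod p) (i j : Fin d) :
    (1 + ∑ k ∈ Finset.Ico 1 d, a (k + 1) • shiftN p d ^ k) i j =
      if (i : ℕ) < j then a (j - i + 1) else if i = j then 1 else 0 := by
  simp only [Matrix.add_apply, Matrix.sum_apply, Matrix.smul_apply, shiftN_pow_apply,
    Matrix.one_apply, smul_eq_mul, mul_ite, mul_one, mul_zero]
  split_ifs with h₁ h₂ h₂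
  · omega
  · rw [Finset.sum_eq_zero, add_zero]
    intro k hk
    rw [Finset.mem_Ico] at hk
    rw [if_neg]
    omega
  · rw [Finset.sum_eq_single ((j : ℕ) - i), if_pos (by omega), zero_add]
    · intro k _ hk
      rw [if_neg]
      omega
    · intro hk
      rw [Finset.mem_Ico] at hk
      omega
  · rw [Finset.sum_eq_zero, add_zero]
    intro k hk
    rw [Finset.mem_Ico] at hk
    rw [if_neg]
    omega

/-- The power series whose first `d` coefficients are the entries of `y`. -/
def rowSeries {p d : ℕ} (y : Fin d → ZMod p) : PowerSeries (ZMod p) :=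
  PowerSeries.mk fun n => if h : n < d then y ⟨n, h⟩ else 0

theorem coeff_rowSeries {p d : ℕ} (y : Fin d → ZMod p) (j : Fin d) :
    PowerSeries.coeff (j : ℕ) (rowSeries y) = y j := by
  simp [rowSeries]

theorem vecMul_unipotentToeplitz {p d : ℕ} {a : ℕ → ZMod p} {F : PowerSeries (ZMod p)}
    (hF : PowerSeries.coeff 0 F = 1) (ha : ∀ k, a (k + 1) = PowerSeries.coeff k F) (y : Fin d → ZMod p) (j : Fin d) :
    vecMul y (1 + ∑ k ∈ Finset.Ico 1 d, a (k + 1) • shiftN p d ^ k) j =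
      PowerSeries.coeff (j : ℕ) (rowSeries y * F) := by
  rw [PowerSeries.coeff_mul, Finset.Nat.sum_antidiagonal_eq_sum_range_succ
    (fun m n => PowerSeries.coeff m (rowSeries y) * PowerSeries.coeff n F)]
  have hsub : Finset.range ((j : ℕ) + 1) ⊆ Finset.range d := by
    intro m hm
    simp only [Finset.mem_range] at hm ⊢
    omega
  have hsum : ∑ m ∈ Finset.range ((j : ℕ) + 1),
      PowerSeries.coeff m (rowSeries y) * PowerSeries.coeff ((j : ℕ) - m) F =
      ∑ m ∈ Finset.range d, if m ≤ (j : ℕ) then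
        PowerSeries.coeff m (rowSeries y) * PowerSeries.coeff ((j : ℕ) - m) F else 0 := by
    rw [← Finset.sum_subset hsub]
    · refine Finset.sum_congr rfl fun m hm => ?_
      rw [if_pos (by simpa [Nat.lt_succ_iff] using hm)]
    · intro m _ hm
      rw [if_neg (by simpa [Nat.lt_succ_iff] using hm)]
  rw [Nat.succ_eq_add_one, hsum, Finset.sum_range]
  simp only [vecMul, dotProduct]
  refine Finset.sum_congr rfl fun i _ => ?_
  rw [unipotentToeplitz_apply, coeff_rowSeries]
  rcases lt_trichotomy (i : ℕ) j with h | h | h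
  · rw [if_pos h, if_pos h.le, ha]
  · obtain rfl := Fin.ext h
    simp [hF, -PowerSeries.coeff_zero_eq_constantCoeff]
  · rw [if_neg (by omega), if_neg (by omega), if_neg (by omega), mul_zero]

/-- The row vectors whose entries before position `i` vanish and whose entry at `i` is `c`. -/
def leadingCell {p d : ℕ} (i : Fin d) (c : ZMod p) : Set (Fin d → ZMod p) :=
  {z | (∀ j < i, z j = 0) ∧ z i = c}

theorem vecMul_mem_leadingCell {p d : ℕ} (a : ℕ → ZMod p) {y : Fin d → ZMod p} {i : Fin d}
    {c : ZMod p} (hy : y ∈ leadingCell i c) :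
    vecMul y (1 + ∑ k ∈ Finset.Ico 1 d, a (k + 1) • shiftN p d ^ k) ∈ leadingCell i c := by
  obtain ⟨h₀, hc⟩ := hy
  have key : ∀ j ≤ i,
      vecMul y (1 + ∑ k ∈ Finset.Ico 1 d, a (k + 1) • shiftN p d ^ k) j = y j := by
    intro j hj
    simp only [vecMul, dotProduct, unipotentToeplitz_apply]
    rw [Finset.sum_eq_single j]
    · simp
    · intro m _ hm
      by_cases hmj : (m : ℕ) < j
      · rw [h₀ m (lt_of_lt_of_le hmj hj), zero_mul]
      · rw [if_neg hmj, if_neg hm, mul_zero]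
    · simp
  exact ⟨fun j hj => (key j hj.le).trans (h₀ j hj), (key i le_rfl).trans hc⟩

theorem exists_rowSeries_eq_X_pow_mul {p d : ℕ} {y : Fin d → ZMod p} {i : Fin d} {c : ZMod p}
    (hy : y ∈ leadingCell i c) :
    ∃ U : PowerSeries (ZMod p), rowSeries y = PowerSeries.X ^ (i : ℕ) * U ∧
      PowerSeries.constantCoeff U = c := by
  obtain ⟨h₀, hc⟩ := hy
  obtain ⟨U, hU⟩ : PowerSeries.X ^ (i : ℕ) ∣ rowSeries y := by
    rw [PowerSeries.X_pow_dvd_iff]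
    intro m hm
    rw [← h₀ ⟨m, hm.trans i.2⟩ hm, ← coeff_rowSeries y]
  refine ⟨U, hU, ?_⟩
  rw [← hc, ← coeff_rowSeries y, hU, ← PowerSeries.coeff_zero_eq_constantCoeff_apply]
  simpa using (PowerSeries.coeff_X_pow_mul U (i : ℕ) 0).symm

theorem exists_vecMul_eq {p : ℕ} [Fact p.Prime] {d : ℕ} {y z : Fin d → ZMod p} {i : Fin d}
    {c : ZMod p} (hc : c ≠ 0) (hy : y ∈ leadingCell i c) (hz : z ∈ leadingCell i c) :
    ∃ a : ℕ → ZMod p,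
      z = vecMul y (1 + ∑ k ∈ Finset.Ico 1 d, a (k + 1) • shiftN p d ^ k) := by
  obtain ⟨U, hU, hUc⟩ := exists_rowSeries_eq_X_pow_mul hy
  obtain ⟨V, hV, hVc⟩ := exists_rowSeries_eq_X_pow_mul hz
  obtain ⟨F, rfl⟩ : U ∣ V :=
    (PowerSeries.isUnit_iff_constantCoeff.mpr (hUc ▸ hc.isUnit)).dvd
  have hF : PowerSeries.coeff 0 F = 1 := by
    rw [map_mul, hUc] at hVc
    rw [PowerSeries.coeff_zero_eq_constantCoeff_apply]
    exact mul_left_cancel₀ hc (hVc.trans (mul_one c).symm)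
  obtain ⟨a, ha⟩ : ∃ a : ℕ → ZMod p, ∀ k, a (k + 1) = PowerSeries.coeff k F :=
    ⟨fun n => PowerSeries.coeff (n - 1) F, fun _ => rfl⟩
  refine ⟨a, funext fun j => ?_⟩
  rw [vecMul_unipotentToeplitz hF ha, hU, mul_assoc, ← hV, coeff_rowSeries]

theorem exists_mem_leadingCell {p d : ℕ} {y : Fin d → ZMod p} (hy : y ≠ 0) :
    ∃ i : Fin d, y i ≠ 0 ∧ y ∈ leadingCell i (y i) := by
  obtain ⟨i₀, h₀⟩ := Function.ne_iff.mp hy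
  obtain ⟨i, hi, hmin⟩ := WellFounded.has_min (wellFounded_lt (α := Fin d)) {i | y i ≠ 0} ⟨i₀, h₀⟩
  exact ⟨i, hi, fun j hj => by_contra fun h => hmin j h hj, rfl⟩

theorem single_mem_leadingCell {p d : ℕ} (i : Fin d) (c : ZMod p) :
    Pi.single i c ∈ leadingCell i c :=
  ⟨fun _ hj => Pi.single_eq_of_ne hj.ne _, Pi.single_eq_same _ _⟩

theorem leadingCell_injective (p d : ℕ) :
    Function.Injective fun x : Fin d × {c : ZMod p // c ≠ 0} => leadingCell x.1 x.2.1 := by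
  rintro ⟨i, c, hc⟩ ⟨j, e, he⟩ h
  dsimp only at h
  have h₁ : Pi.single i c ∈ leadingCell j e := h ▸ single_mem_leadingCell i c
  have hij : i = j := by
    by_contra hne
    exact he (h₁.2.symm.trans (Pi.single_eq_of_ne (Ne.symm hne) _))
  subst hij
  have hce : c = e := by simpa using h₁.2
  subst hce
  rfl

/-- The number of orbits of the group of upper triangular unipotent Toeplitz matrices
over `ℤ/pℤ`, acting on row vectors of `(ℤ/pℤ)^d` by `y ↦ yA`, is `1 + (p-1)d`. -/
theorem stmt17 (p : ℕ) [Fact p.Prime] (d : ℕ) (hd : 0 < d)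
    (Γ : Set (Matrix (Fin d) (Fin d) (ZMod p)))
    (hΓ : Γ = {A | ∃ a : ℕ → ZMod p,
      A = 1 + ∑ k ∈ Finset.Ico 1 d, a (k + 1) • shiftN p d ^ k})
    (orb : (Fin d → ZMod p) → Set (Fin d → ZMod p))
    (horb : ∀ y, orb y = {z | ∃ A ∈ Γ, z = Matrix.vecMul y A}) :
    {S | ∃ y, S = orb y}.ncard = 1 + (p - 1) * d := by
  subst hΓ
  have orb_zero : orb 0 = {0} := by
    rw [horb]
    ext z
    simp
  have orb_cell {y : Fin d → ZMod p} {i : Fin d} {c : ZMod p} (hc : c ≠ 0)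
      (hy : y ∈ leadingCell i c) : orb y = leadingCell i c := by
    rw [horb]
    ext z
    constructor
    · rintro ⟨_, ⟨a, rfl⟩, rfl⟩
      exact vecMul_mem_leadingCell a hy
    · intro hz
      obtain ⟨a, ha⟩ := exists_vecMul_eq hc hy hz
      exact ⟨_, ⟨a, rfl⟩, ha⟩
  have orbits_eq : {S | ∃ y, S = orb y} = insert {0}
      (Set.range fun x : Fin d × {c : ZMod p // c ≠ 0} => leadingCell x.1 x.2.1) := by
    ext S
    constructor
    · rintro ⟨y, rfl⟩
      by_cases hy : y = 0
      · exact Or.inl (hy ▸ orb_zero)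
      · obtain ⟨i, hi, hmem⟩ := exists_mem_leadingCell hy
        exact Or.inr ⟨(i, ⟨y i, hi⟩), (orb_cell hi hmem).symm⟩
    · rintro (rfl | ⟨⟨i, c, hc⟩, rfl⟩)
      · exact ⟨0, orb_zero.symm⟩
      · exact ⟨_, (orb_cell hc (single_mem_leadingCell i c)).symm⟩
  have zero_notMem : ({0} : Set (Fin d → ZMod p)) ∉
      Set.range fun x : Fin d × {c : ZMod p // c ≠ 0} => leadingCell x.1 x.2.1 := by
    rintro ⟨⟨i, c, hc⟩, h⟩
    have h₀ : (0 : Fin d → ZMod p) ∈ leadingCell i c := h.ge rfl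
    exact hc h₀.2.symm
  rw [orbits_eq, Set.ncard_insert_of_notMem zero_notMem (Set.finite_range _),
    Set.ncard_range_of_injective (leadingCell_injective p d), Nat.card_prod,
    Nat.card_eq_fintype_card (α := {c : ZMod p // c ≠ 0}), Fintype.card_subtype_compl]
  simp [ZMod.card]
  ring
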